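/- In the perturbed Gaussian setting (standard normal ρ_X on ℝ^n, f continuously differentiable with ρ_X-square-integrable gradient, eigenvalues λ₁ ≥ ⋯ ≥ λ_n ≥ 0 of C = ∫ ∇f ∇fᵀ ρ_X dx, orthogonal Ŵ = [Ŵ₁ Ŵ₂] with ‖W − Ŵ‖ ≤ ε, ĝ the conditional expectation over the perturbed inactive variable, f_ĝ(x) = ĝ(Ŵ₁ᵀx)), let ĝ_N(ŷ,ω) = (1/N) Σ_{j=1}^N f(Ŵ₁ŷ + Ŵ₂ Ẑ_j^ŷ(ω)) with Ẑ₁^ŷ, …, Ẑ_N^ŷ i.i.d. with density φ_{n−k}, jointly measurable in (ŷ,ω), and f_{ĝ_N}(x,ω) = ĝ_N(Ŵ₁ᵀx,ω). Then E[ ∫_{ℝ^n} (f_ĝ(x) − f_{ĝ_N}(x,·))² ρ_X(x) dx ] ≤ (1/N) ( ε(λ₁ + ⋯ + λ_k)^{1/2} + (λ_{k+1} + ⋯ + λ_n)^{1/2} )². -/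

import Mathlib

open MeasureTheory Matrix Set ProbabilityTheory
open scoped Matrix.Norms.L2Operator

/-- The standard normal density on `ℝ^n`. -/
noncomputable def gaussDensity (n : ℕ) (x : Fin n → ℝ) : ℝ :=
  (2 * Real.pi) ^ (-(n : ℝ) / 2) * Real.exp (-(∑ i, x i ^ 2) / 2)

/-- The vector of partial derivatives (gradient) of `f : ℝ^n → ℝ`. -/
noncomputable def pgrad {n : ℕ} (f : (Fin n → ℝ) → ℝ) (x : Fin n → ℝ) : Fin n → ℝ :=
  fun i => fderiv ℝ f x (Pi.single i 1)


/-- Standard Gaussian product measure. -/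
noncomputable def gam (n : ℕ) : Measure (Fin n → ℝ) := Measure.pi fun _ => gaussianReal 0 1

instance gam_prob (n : ℕ) : IsProbabilityMeasure (gam n) := by unfold gam; infer_instance

lemma gaussDensity_nonneg (n : ℕ) (x : Fin n → ℝ) : 0 ≤ gaussDensity n x := by
  unfold gaussDensity; positivity

lemma gaussDensity_continuous (n : ℕ) : Continuous (gaussDensity n) := by
  unfold gaussDensity; fun_prop

lemma gaussDensity_eq_prod (n : ℕ) (x : Fin n → ℝ) :
    gaussDensity n x = ∏ i, gaussianPDFReal 0 1 (x i) := by
  simp only [gaussDensity, gaussianPDFReal, Finset.prod_mul_distrib, ← Real.exp_sum]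
  congr 1
  · simp only [NNReal.coe_one, mul_one, Finset.prod_const, Finset.card_univ, Fintype.card_fin]
    rw [Real.sqrt_eq_rpow, ← Real.rpow_neg (by positivity), ← Real.rpow_natCast,
      ← Real.rpow_mul (by positivity)]
    congr 1; ring
  · congr 1
    rw [← Finset.sum_neg_distrib, Finset.sum_div]
    simp

lemma gam_eq (n : ℕ) :
    gam n = volume.withDensity fun z => ENNReal.ofReal (gaussDensity n z) := by
  unfold gam
  refine Measure.pi_eq fun s hs => ?_
  rw [withDensity_apply _ (MeasurableSet.univ_pi hs),
    ← lintegral_indicator (MeasurableSet.univ_pi hs)]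
  have h1 : ∀ i, (gaussianReal 0 1) (s i) =
      ENNReal.ofReal (∫ x, (s i).indicator (gaussianPDFReal 0 1) x) := by
    intro i
    rw [gaussianReal_apply_eq_integral _ one_ne_zero, integral_indicator (hs i)]
  simp_rw [h1]
  rw [← ENNReal.ofReal_prod_of_nonneg (fun i _ => integral_nonneg fun x =>
    Set.indicator_nonneg (fun _ _ => gaussianPDFReal_nonneg _ _ _) _),
    ← integral_fintype_prod_volume_eq_prod (fun i x => (s i).indicator (gaussianPDFReal 0 1) x),
    ofReal_integral_eq_lintegral_ofReal]
  · refine lintegral_congr fun x => ?_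
    by_cases hx : x ∈ Set.univ.pi s
    · rw [Set.indicator_of_mem hx, gaussDensity_eq_prod]
      congr 1
      refine Finset.prod_congr rfl fun i _ => ?_
      rw [Set.indicator_of_mem (hx i trivial)]
    · rw [Set.indicator_of_notMem hx]
      simp only [Set.mem_univ_pi, not_forall] at hx
      obtain ⟨i, hi⟩ := hx
      rw [Finset.prod_eq_zero (Finset.mem_univ i) (Set.indicator_of_notMem hi _)]
      simp
  · exact Integrable.fintype_prod (f := fun i x => (s i).indicator (gaussianPDFReal 0 1) x)
      fun i => (integrable_gaussianPDFReal 0 1).indicator (hs i)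
  · exact ae_of_all _ fun x => Finset.prod_nonneg fun i _ =>
      Set.indicator_nonneg (fun _ _ => gaussianPDFReal_nonneg _ _ _) _

lemma gam_append (k m : ℕ) :
    MeasurePreserving (fun p : (Fin k → ℝ) × (Fin m → ℝ) => Fin.append p.1 p.2)
      ((gam k).prod (gam m)) (gam (k + m)) := by
  have hm : Measurable (fun p : (Fin k → ℝ) × (Fin m → ℝ) => Fin.append p.1 p.2) := by
    refine measurable_pi_lambda _ fun i => ?_
    refine Fin.addCases (fun i => ?_) (fun i => ?_) i
    · simp only [Fin.append_left]; fun_prop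
    · simp only [Fin.append_right]; fun_prop
  refine ⟨hm, ?_⟩
  symm
  conv_lhs => unfold gam
  refine Measure.pi_eq fun s hs => ?_
  rw [Measure.map_apply hm (MeasurableSet.univ_pi hs)]
  have : (fun p : (Fin k → ℝ) × (Fin m → ℝ) => Fin.append p.1 p.2) ⁻¹' (Set.univ.pi s) =
      (Set.univ.pi fun i => s (Fin.castAdd m i)) ×ˢ (Set.univ.pi fun i => s (Fin.natAdd k i)) := by
    ext p
    simp only [Set.mem_preimage, Set.mem_univ_pi, Set.mem_prod, Fin.forall_fin_add,
      Fin.append_left, Fin.append_right]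
  rw [this, Measure.prod_prod, Fin.prod_univ_add]
  simp [gam]

lemma gam_cons (m : ℕ) :
    MeasurePreserving (fun p : ℝ × (Fin m → ℝ) => (Fin.cons p.1 p.2 : Fin (m + 1) → ℝ))
      ((gaussianReal 0 1).prod (gam m)) (gam (m + 1)) := by
  have hm : Measurable (fun p : ℝ × (Fin m → ℝ) => (Fin.cons p.1 p.2 : Fin (m + 1) → ℝ)) := by
    refine measurable_pi_lambda _ fun i => ?_
    refine Fin.cases ?_ (fun i => ?_) i
    · simp only [Fin.cons_zero]; fun_prop
    · simp only [Fin.cons_succ]; fun_prop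
  refine ⟨hm, ?_⟩
  symm
  conv_lhs => unfold gam
  refine Measure.pi_eq fun s hs => ?_
  rw [Measure.map_apply hm (MeasurableSet.univ_pi hs)]
  have : (fun p : ℝ × (Fin m → ℝ) => (Fin.cons p.1 p.2 : Fin (m + 1) → ℝ)) ⁻¹' (Set.univ.pi s) =
      (s 0) ×ˢ (Set.univ.pi fun i => s (Fin.succ i)) := by
    ext p
    simp only [Set.mem_preimage, Set.mem_univ_pi, Set.mem_prod, Fin.forall_fin_succ,
      Fin.cons_zero, Fin.cons_succ]
  rw [this, Measure.prod_prod, Fin.prod_univ_succ]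
  simp [gam]

lemma orth_sum_sq {n : ℕ} {U : Matrix (Fin n) (Fin n) ℝ} (hU : Uᵀ * U = 1) (x : Fin n → ℝ) :
    ∑ i, (U *ᵥ x) i ^ 2 = ∑ i, x i ^ 2 := by
  have : (U *ᵥ x) ⬝ᵥ (U *ᵥ x) = x ⬝ᵥ x := by
    rw [Matrix.dotProduct_mulVec, Matrix.vecMul_mulVec, hU, Matrix.vecMul_one]
  simpa [dotProduct, sq] using this

lemma gam_orth {n : ℕ} {U : Matrix (Fin n) (Fin n) ℝ} (hU : Uᵀ * U = 1) :
    MeasurePreserving (fun x => U *ᵥ x) (gam n) (gam n) := by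
  have hc : Continuous (fun x : Fin n → ℝ => U *ᵥ x) := by fun_prop
  have hdet : |U.det| = 1 := by
    have := congrArg Matrix.det hU
    rw [Matrix.det_mul, Matrix.det_transpose, Matrix.det_one] at this
    have h2 : |U.det| * |U.det| = 1 := by rw [← abs_mul, this, abs_one]
    nlinarith [abs_nonneg U.det]
  have hvol : MeasurePreserving (fun x : Fin n → ℝ => U *ᵥ x) volume volume := by
    refine ⟨hc.measurable, ?_⟩
    have h0 : U.det ≠ 0 := by intro h; simp [h] at hdet
    have := Real.map_matrix_volume_pi_eq_smul_volume_pi h0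
    rw [abs_inv, hdet] at this
    have e : (fun x : Fin n → ℝ => U *ᵥ x) = ⇑(toLin' U) := by
      ext x; simp
    rw [e, this]; simp
  refine ⟨hc.measurable, ?_⟩
  have hd : Measurable fun z => ENNReal.ofReal (gaussDensity n z) :=
    (gaussDensity_continuous n).measurable.ennreal_ofReal
  rw [gam_eq]
  ext s hs
  rw [Measure.map_apply hc.measurable hs, withDensity_apply _ hs,
    withDensity_apply _ (hc.measurable hs), ← hvol.setLIntegral_comp_preimage hs hd]
  refine lintegral_congr fun x => ?_
  simp only [gaussDensity, orth_sum_sq hU]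

/-- Symmetrized variance. -/
noncomputable def symv {α : Type*} [MeasurableSpace α] (X : α → ℝ) (μ : Measure α) : ENNReal :=
  ∫⁻ p, ∫⁻ q, ENNReal.ofReal ((X p - X q) ^ 2) ∂μ ∂μ

lemma memLp_two_of_lintegral {α : Type*} [MeasurableSpace α] {μ : Measure α} {X : α → ℝ}
    (hX : Measurable X) (h : ∫⁻ p, ENNReal.ofReal (X p ^ 2) ∂μ ≠ ⊤) : MemLp X 2 μ := by
  rw [memLp_two_iff_integrable_sq hX.aestronglyMeasurable]
  refine ⟨(hX.pow_const 2).aestronglyMeasurable, ?_⟩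
  rw [hasFiniteIntegral_iff_ofReal (ae_of_all _ fun _ => sq_nonneg _)]
  exact h.lt_top

lemma symv_eq {α : Type*} [MeasurableSpace α] {μ : Measure α} [IsProbabilityMeasure μ]
    {X : α → ℝ} (hX : Measurable X) : symv X μ = 2 * eVar[X; μ] := by
  by_cases hL : MemLp X 2 μ
  · have hi : Integrable X μ := hL.integrable one_le_two
    have hi2 : Integrable (fun p => X p ^ 2) μ := hL.integrable_sq
    have h1 : ∀ p, ∫⁻ q, ENNReal.ofReal ((X p - X q) ^ 2) ∂μ =
        ENNReal.ofReal (X p ^ 2 - 2 * X p * μ[X] + ∫ q, X q ^ 2 ∂μ) := by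
      intro p
      have e : (fun q => (X p - X q) ^ 2) = fun q => X p ^ 2 - 2 * X p * X q + X q ^ 2 := by
        ext q; ring
      have hInt1 : Integrable (fun q => X p ^ 2 - 2 * X p * X q) μ :=
        (integrable_const _).sub (hi.const_mul _)
      rw [← ofReal_integral_eq_lintegral_ofReal _ (ae_of_all _ fun _ => sq_nonneg _)]
      · rw [e, integral_add hInt1 hi2, integral_sub (integrable_const _) (hi.const_mul _),
          integral_const_mul]
        simp
      · rw [e]; exact hInt1.add hi2
    unfold symv
    simp_rw [h1]
    have hInt1 : Integrable (fun p => X p ^ 2 - 2 * X p * μ[X]) μ :=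
      hi2.sub ((hi.const_mul 2).mul_const _)
    have hInt2 : Integrable (fun p => X p ^ 2 - 2 * X p * μ[X] + ∫ q, X q ^ 2 ∂μ) μ :=
      hInt1.add (integrable_const _)
    rw [← ofReal_integral_eq_lintegral_ofReal hInt2, ← ofReal_variance hL,
      variance_eq_sub hL]
    · rw [integral_add hInt1 (integrable_const _), integral_sub hi2 ((hi.const_mul 2).mul_const _),
          integral_mul_const, integral_const_mul, show (2 : ENNReal) = ENNReal.ofReal 2 by simp,
          ← ENNReal.ofReal_mul (by norm_num)]
      congr 1
      simp
      ring
    · refine ae_of_all _ fun p => ?_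
      have e : X p ^ 2 - 2 * X p * μ[X] + ∫ q, X q ^ 2 ∂μ = (X p - μ[X]) ^ 2 + Var[X; μ] := by
        rw [variance_eq_sub hL]; simp; ring
      have := variance_nonneg X μ
      change 0 ≤ X p ^ 2 - 2 * X p * μ[X] + ∫ q, X q ^ 2 ∂μ
      rw [e]; positivity
  · rw [evariance_eq_top hX.aestronglyMeasurable hL]
    have : symv X μ = ⊤ := by
      by_contra hne
      apply hL
      have hm : Measurable fun p => ∫⁻ q, ENNReal.ofReal ((X p - X q) ^ 2) ∂μ := by
        refine Measurable.lintegral_prod_right' (f := fun pq : α × α => ENNReal.ofReal ((X pq.1 - X pq.2) ^ 2)) ?_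
        fun_prop
      obtain ⟨p, hp⟩ := (ae_lt_top hm hne).exists
      have h2 : MemLp (fun q => X p - X q) 2 μ := memLp_two_of_lintegral (by fun_prop) hp.ne
      have h3 := (memLp_const (X p)).sub h2
      refine h3.ae_eq (ae_of_all _ fun q => ?_)
      simp
    rw [this]; simp

lemma evar_le {α : Type*} [MeasurableSpace α] {μ : Measure α} [IsProbabilityMeasure μ]
    {X : α → ℝ} (hX : Measurable X) (c : ℝ) :
    eVar[X; μ] ≤ ∫⁻ p, ENNReal.ofReal ((X p - c) ^ 2) ∂μ := by
  by_cases h : ∫⁻ p, ENNReal.ofReal ((X p - c) ^ 2) ∂μ = ⊤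
  · rw [h]; exact le_top
  have h2 : MemLp (fun p => X p - c) 2 μ := memLp_two_of_lintegral (by fun_prop) h
  have h3 : MemLp X 2 μ := by
    refine (h2.add (memLp_const c)).ae_eq (ae_of_all _ fun q => ?_)
    simp
  rw [← ofReal_variance h3, ← ofReal_integral_eq_lintegral_ofReal h2.integrable_sq
    (ae_of_all _ fun _ => sq_nonneg _), ← variance_sub_const hX.aestronglyMeasurable c]
  exact ENNReal.ofReal_le_ofReal (variance_le_expectation_sq h2.1)

lemma symv_prod {α β : Type*} [MeasurableSpace α] [MeasurableSpace β] {μ : Measure α}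
    {ν : Measure β} [IsProbabilityMeasure μ] [IsProbabilityMeasure ν] {F : α × β → ℝ}
    (hF : Measurable F) :
    symv F (μ.prod ν) ≤ (∫⁻ y, symv (fun x => F (x, y)) μ ∂ν) + ∫⁻ x, symv (fun y => F (x, y)) ν ∂μ := by
  let q : ℝ → ENNReal := fun t => ENNReal.ofReal (t ^ 2)
  have hq : Measurable q := by fun_prop
  let ρ := (μ.prod μ).prod (ν.prod ν)
  let a : (α × α) × (β × β) → ℝ := fun w => F (w.1.1, w.2.1)
  let b : (α × α) × (β × β) → ℝ := fun w => F (w.1.2, w.2.1)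
  let c : (α × α) × (β × β) → ℝ := fun w => F (w.1.1, w.2.2)
  let d : (α × α) × (β × β) → ℝ := fun w => F (w.1.2, w.2.2)
  have ha : Measurable a := by fun_prop
  have hb : Measurable b := by fun_prop
  have hc : Measurable c := by fun_prop
  have hd : Measurable d := by fun_prop
  have key : ∫⁻ w, (q (a w - d w) + q (b w - c w)) ∂ρ ≤
      ∫⁻ w, ((q (a w - b w) + q (c w - d w)) + (q (a w - c w) + q (b w - d w))) ∂ρ := by
    refine lintegral_mono fun w => ?_
    simp only [q]
    rw [← ENNReal.ofReal_add (sq_nonneg _) (sq_nonneg _), ← ENNReal.ofReal_add (sq_nonneg _) (sq_nonneg _),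
      ← ENNReal.ofReal_add (sq_nonneg _) (sq_nonneg _), ← ENNReal.ofReal_add (by positivity) (by positivity)]
    refine ENNReal.ofReal_le_ofReal ?_
    nlinarith [sq_nonneg (a w - b w - c w + d w)]
  have E : ∀ G : (α × α) × (β × β) → ENNReal, Measurable G → ∫⁻ w, G w ∂ρ =
      ∫⁻ x, ∫⁻ x', ∫⁻ y, ∫⁻ y', G ((x, x'), (y, y')) ∂ν ∂ν ∂μ ∂μ := by
    intro G hG
    simp only [ρ]
    rw [lintegral_prod _ hG.aemeasurable, lintegral_prod _ (hG.lintegral_prod_right').aemeasurable]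
    refine lintegral_congr fun x => lintegral_congr fun x' => ?_
    rw [lintegral_prod _ (by fun_prop)]
  have had : ∫⁻ w, q (a w - d w) ∂ρ = symv F (μ.prod ν) := by
    rw [E _ (by fun_prop)]
    unfold symv
    rw [lintegral_prod]
    · refine lintegral_congr fun x => ?_
      rw [lintegral_lintegral_swap]
      · refine lintegral_congr fun y => ?_
        rw [lintegral_prod _ (by fun_prop)]
      · refine Measurable.aemeasurable ?_
        refine Measurable.lintegral_prod_right' (f := fun w : (α × β) × β => q (a ((x, w.1.1), (w.1.2, w.2)) - d ((x, w.1.1), (w.1.2, w.2)))) ?_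
        fun_prop
    · refine Measurable.aemeasurable ?_
      refine Measurable.lintegral_prod_right' (f := fun pq : (α × β) × (α × β) => ENNReal.ofReal ((F pq.1 - F pq.2) ^ 2)) ?_
      fun_prop
  have hbc : ∫⁻ w, q (b w - c w) ∂ρ = symv F (μ.prod ν) := by
    rw [← had, E _ (by fun_prop), E _ (by fun_prop), lintegral_lintegral_swap]
    refine Measurable.aemeasurable ?_
    refine Measurable.lintegral_prod_right' (f := fun w : (α × α) × β => ∫⁻ y', q (b (w.1, (w.2, y')) - c (w.1, (w.2, y'))) ∂ν) ?_
    refine Measurable.lintegral_prod_right' (f := fun w : ((α × α) × β) × β => q (b (w.1.1, (w.1.2, w.2)) - c (w.1.1, (w.1.2, w.2)))) ?_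
    fun_prop
  have hsx : ∫⁻ x, ∫⁻ x', ∫⁻ y, q (F (x, y) - F (x', y)) ∂ν ∂μ ∂μ =
      ∫⁻ y, symv (fun x => F (x, y)) μ ∂ν := by
    unfold symv
    rw [lintegral_lintegral_swap (μ := ν)]
    · refine lintegral_congr fun x => ?_
      rw [lintegral_lintegral_swap]
      exact Measurable.aemeasurable (by fun_prop)
    · refine Measurable.aemeasurable ?_
      refine Measurable.lintegral_prod_right' (f := fun w : (β × α) × α => q (F (w.1.2, w.1.1) - F (w.2, w.1.1))) ?_
      fun_prop
  have hab : ∫⁻ w, q (a w - b w) ∂ρ = ∫⁻ y, symv (fun x => F (x, y)) μ ∂ν := by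
    rw [E _ (by fun_prop), ← hsx]
    simp [a, b]
  have hcd : ∫⁻ w, q (c w - d w) ∂ρ = ∫⁻ y, symv (fun x => F (x, y)) μ ∂ν := by
    rw [E _ (by fun_prop), ← hsx]
    simp [c, d]
  have hac : ∫⁻ w, q (a w - c w) ∂ρ = ∫⁻ x, symv (fun y => F (x, y)) ν ∂μ := by
    rw [E _ (by fun_prop)]
    simp [a, c, symv, q]
  have hbd : ∫⁻ w, q (b w - d w) ∂ρ = ∫⁻ x, symv (fun y => F (x, y)) ν ∂μ := by
    rw [E _ (by fun_prop)]
    simp [b, d, symv, q]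
  rw [lintegral_add_left (by fun_prop), lintegral_add_left (by fun_prop),
    lintegral_add_left (by fun_prop), lintegral_add_left (by fun_prop), had, hbc, hab, hcd, hac,
    hbd, ← two_mul, ← two_mul, ← two_mul, ← mul_add] at key
  exact (ENNReal.mul_le_mul_iff_right (by norm_num) (by norm_num)).1 key

lemma sq_sub_le {f : ℝ → ℝ} (hf : ContDiff ℝ 1 f) {a b : ℝ} (hab : a < b) :
    (f b - f a) ^ 2 ≤ (b - a) * ∫ t in a..b, deriv f t ^ 2 := by
  have hc : Continuous (deriv f) := hf.continuous_deriv le_rfl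
  have h1 : ∫ t in a..b, deriv f t = f b - f a :=
    intervalIntegral.integral_deriv_eq_sub (fun x _ => (hf.differentiable one_ne_zero) x)
      (hc.intervalIntegrable _ _)
  set s := f b - f a
  have hL : 0 < b - a := sub_pos.2 hab
  have h2 : 0 ≤ ∫ t in a..b, ((b - a) * deriv f t - s) ^ 2 :=
    intervalIntegral.integral_nonneg hab.le fun _ _ => sq_nonneg _
  have h3 : ∫ t in a..b, ((b - a) * deriv f t - s) ^ 2 =
      (b - a) ^ 2 * (∫ t in a..b, deriv f t ^ 2) - 2 * (b - a) * s * s + (b - a) * s ^ 2 := by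
    have e : (fun t => ((b - a) * deriv f t - s) ^ 2) =
        fun t => (b - a) ^ 2 * deriv f t ^ 2 - 2 * (b - a) * s * deriv f t + s ^ 2 := by
      ext t; ring
    rw [e, intervalIntegral.integral_add, intervalIntegral.integral_sub,
      intervalIntegral.integral_const_mul, intervalIntegral.integral_const_mul, h1]
    · simp
    all_goals exact Continuous.intervalIntegrable (by fun_prop) _ _
  rw [h3] at h2
  have h4 : 0 ≤ (b - a) * ((b - a) * (∫ t in a..b, deriv f t ^ 2) - s ^ 2) := by nlinarith
  have := nonneg_of_mul_nonneg_right h4 hL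
  linarith

lemma pt_bound {f : ℝ → ℝ} (hf : ContDiff ℝ 1 f) (x : ℝ) :
    ENNReal.ofReal ((f x - f 0) ^ 2) ≤
      ENNReal.ofReal |x| * ∫⁻ t in Set.uIoc 0 x, ENNReal.ofReal (deriv f t ^ 2) := by
  have hc : Continuous (deriv f) := hf.continuous_deriv le_rfl
  have hii : ∀ a b : ℝ, a ≤ b → ENNReal.ofReal (∫ t in a..b, deriv f t ^ 2) =
      ∫⁻ t in Set.Ioc a b, ENNReal.ofReal (deriv f t ^ 2) := by
    intro a b hab
    rw [intervalIntegral.integral_of_le hab, ofReal_integral_eq_lintegral_ofReal]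
    · exact ((hc.pow 2).intervalIntegrable a b).1
    · exact ae_of_all _ fun _ => sq_nonneg _
  rcases lt_trichotomy x 0 with h | h | h
  · rw [Set.uIoc_of_ge h.le, ← hii _ _ h.le, ← ENNReal.ofReal_mul (abs_nonneg _), abs_of_neg h]
    refine ENNReal.ofReal_le_ofReal ?_
    have := sq_sub_le hf h
    rw [zero_sub] at this
    linarith [this, sq_nonneg (f x - f 0), show (f x - f 0) ^ 2 = (f 0 - f x) ^ 2 by ring]
  · simp [h]
  · rw [Set.uIoc_of_le h.le, ← hii _ _ h.le, ← ENNReal.ofReal_mul (abs_nonneg _), abs_of_pos h]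
    refine ENNReal.ofReal_le_ofReal ?_
    have := sq_sub_le hf h
    rwa [sub_zero] at this

lemma phi_deriv (x : ℝ) : HasDerivAt (gaussianPDFReal 0 1) (-x * gaussianPDFReal 0 1 x) x := by
  simp only [gaussianPDFReal_def]
  have h : HasDerivAt (fun x : ℝ => -(x - 0) ^ 2 / (2 * ((1 : NNReal) : ℝ))) (-x) x := by
    have := (((hasDerivAt_id x).sub_const 0).pow 2).neg.div_const (2 * ((1 : NNReal) : ℝ))
    exact this.congr_deriv (by simp; ring)
  exact (h.exp.const_mul (√(2 * Real.pi * ((1 : NNReal) : ℝ)))⁻¹).congr_deriv (by ring)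

lemma phi_tendsto_top : Filter.Tendsto (gaussianPDFReal 0 1) Filter.atTop (nhds 0) := by
  simp only [gaussianPDFReal_def]
  rw [show (0 : ℝ) = (√(2 * Real.pi * ((1 : NNReal) : ℝ)))⁻¹ * 0 by simp]
  refine Filter.Tendsto.const_mul _ ?_
  refine Real.tendsto_exp_atBot.comp ?_
  simp only [NNReal.coe_one, mul_one, mul_zero, sub_zero]
  have : Filter.Tendsto (fun x : ℝ => x ^ 2 / 2) Filter.atTop Filter.atTop :=
    (Filter.tendsto_pow_atTop two_ne_zero).atTop_div_const (by norm_num)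
  refine (Filter.tendsto_neg_atTop_atBot.comp this).congr fun x => ?_
  simp [neg_div]

lemma phi_even (x : ℝ) : gaussianPDFReal 0 1 (-x) = gaussianPDFReal 0 1 x := by
  simp [gaussianPDFReal]

lemma tail_pos (t : ℝ) (ht : 0 ≤ t) :
    ∫⁻ x in Set.Ioi t, ENNReal.ofReal (|x| * gaussianPDFReal 0 1 x) =
      ENNReal.ofReal (gaussianPDFReal 0 1 t) := by
  have hd : ∀ x ∈ Set.Ici t, HasDerivAt (fun x => -gaussianPDFReal 0 1 x)
      (x * gaussianPDFReal 0 1 x) x := by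
    intro x _
    exact (phi_deriv x).neg.congr_deriv (by ring)
  have hn : ∀ x ∈ Set.Ioi t, 0 ≤ x * gaussianPDFReal 0 1 x := fun x hx =>
    mul_nonneg (ht.trans (le_of_lt hx)) (gaussianPDFReal_nonneg _ _ _)
  have htd : Filter.Tendsto (fun x => -gaussianPDFReal 0 1 x) Filter.atTop (nhds 0) := by
    simpa using phi_tendsto_top.neg
  have hI := integrableOn_Ioi_deriv_of_nonneg' hd hn htd
  have hV := integral_Ioi_of_hasDerivAt_of_nonneg' hd hn htd
  have e : ∫⁻ x in Set.Ioi t, ENNReal.ofReal (|x| * gaussianPDFReal 0 1 x) =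
      ∫⁻ x in Set.Ioi t, ENNReal.ofReal (x * gaussianPDFReal 0 1 x) := by
    refine setLIntegral_congr_fun measurableSet_Ioi fun x hx => ?_
    rw [abs_of_nonneg (ht.trans (le_of_lt hx))]
  rw [e, ← ofReal_integral_eq_lintegral_ofReal hI
    ((ae_restrict_iff' measurableSet_Ioi).2 (ae_of_all _ hn)), hV]
  simp

open Classical in
lemma tail_all (t : ℝ) :
    ∫⁻ x, (if t ∈ Set.uIoc 0 x then ENNReal.ofReal (|x| * gaussianPDFReal 0 1 x) else 0) ≤
      ENNReal.ofReal (gaussianPDFReal 0 1 t) := by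
  rcases lt_or_ge 0 t with ht | ht
  · rw [← tail_pos t ht.le, ← setLIntegral_congr Ioi_ae_eq_Ici.symm, ← lintegral_indicator measurableSet_Ici]
    refine lintegral_mono fun x => ?_
    simp only [Set.indicator, Set.mem_Ici, Set.mem_uIoc]
    split_ifs with h1 h2
    · exact le_rfl
    · exfalso; rcases h1 with h1 | h1 <;> [linarith [h1.2]; linarith [h1.2]]
    · exact zero_le
    · exact le_rfl
  · rw [← phi_even t, ← tail_pos (-t) (by linarith), ← lintegral_indicator measurableSet_Ioi,
      ← lintegral_neg_eq_self]
    refine lintegral_mono fun x => ?_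
    simp only [Set.indicator, Set.mem_Ioi, Set.mem_uIoc, abs_neg, phi_even]
    split_ifs with h1 h2
    · exact le_rfl
    · exfalso; rcases h1 with h1 | h1 <;> [linarith [h1.1]; linarith [h1.1]]
    · exact zero_le
    · exact le_rfl

open Classical in
lemma poincare_one {f : ℝ → ℝ} (hf : ContDiff ℝ 1 f) :
    eVar[f; gaussianReal 0 1] ≤ ∫⁻ x, ENNReal.ofReal (deriv f x ^ 2) ∂(gaussianReal 0 1) := by
  have hc : Continuous (deriv f) := hf.continuous_deriv le_rfl
  refine (evar_le hf.continuous.measurable (f 0)).trans ?_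
  have hm : Measurable (gaussianPDF 0 1) := measurable_gaussianPDF 0 1
  have hmf := hf.continuous.measurable
  have hmd := hc.measurable
  rw [gaussianReal_of_var_ne_zero _ one_ne_zero, lintegral_withDensity_eq_lintegral_mul _ hm (by fun_prop),
    lintegral_withDensity_eq_lintegral_mul _ hm (by fun_prop)]
  have hset : MeasurableSet {p : ℝ × ℝ | p.2 ∈ Set.uIoc 0 p.1} := by
    simp only [Set.mem_uIoc]
    measurability
  calc ∫⁻ x, (gaussianPDF 0 1 * fun x => ENNReal.ofReal ((f x - f 0) ^ 2)) x
      ≤ ∫⁻ x, ∫⁻ t, ENNReal.ofReal (deriv f t ^ 2) *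
        (if t ∈ Set.uIoc 0 x then ENNReal.ofReal (|x| * gaussianPDFReal 0 1 x) else 0) := by
        refine lintegral_mono fun x => ?_
        simp only [Pi.mul_apply, gaussianPDF]
        refine (mul_le_mul_right (pt_bound hf x) _).trans (le_of_eq ?_)
        rw [← lintegral_indicator measurableSet_uIoc, ← mul_assoc, ← ENNReal.ofReal_mul
          (gaussianPDFReal_nonneg _ _ _), ← lintegral_const_mul']
        · refine lintegral_congr fun t => ?_
          by_cases h : t ∈ Set.uIoc 0 x
          · simp only [Set.indicator, h, if_true]
            rw [mul_comm, mul_comm |x|]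
          · simp [Set.indicator, h]
        · exact ENNReal.ofReal_ne_top
    _ = ∫⁻ t, ∫⁻ x, ENNReal.ofReal (deriv f t ^ 2) *
        (if t ∈ Set.uIoc 0 x then ENNReal.ofReal (|x| * gaussianPDFReal 0 1 x) else 0) := by
        refine lintegral_lintegral_swap (Measurable.aemeasurable ?_)
        refine Measurable.mul (by fun_prop) (Measurable.ite hset ?_ measurable_const)
        have := measurable_gaussianPDFReal 0 1
        fun_prop
    _ ≤ _ := by
        refine lintegral_mono fun t => ?_
        rw [lintegral_const_mul' _ _ ENNReal.ofReal_ne_top]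
        simp only [Pi.mul_apply, gaussianPDF]
        rw [mul_comm]
        exact mul_le_mul_left (tail_all t) _

lemma symv_map {α β : Type*} [MeasurableSpace α] [MeasurableSpace β] {μ : Measure α}
    {ν : Measure β} [SFinite ν] {T : α → β} (hT : MeasurePreserving T μ ν) {h : β → ℝ}
    (hh : Measurable h) : symv h ν = symv (fun x => h (T x)) μ := by
  unfold symv
  rw [← hT.lintegral_comp]
  · refine lintegral_congr fun x => ?_
    rw [← hT.lintegral_comp (by fun_prop)]
  · refine Measurable.lintegral_prod_right'
      (f := fun w : β × β => ENNReal.ofReal ((h w.1 - h w.2) ^ 2)) ?_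
    fun_prop

lemma contDiff_cons (m : ℕ) : ContDiff ℝ 1
    (fun p : ℝ × (Fin m → ℝ) => (Fin.cons p.1 p.2 : Fin (m + 1) → ℝ)) := by
  rw [contDiff_pi]
  intro i
  refine Fin.cases ?_ (fun i => ?_) i
  · simp only [Fin.cons_zero]; fun_prop
  · simp only [Fin.cons_succ]; fun_prop

lemma pgrad_eq_lineDeriv {n : ℕ} {h : (Fin n → ℝ) → ℝ} (hh : ContDiff ℝ 1 h) (x : Fin n → ℝ)
    (i : Fin n) : pgrad h x i = lineDeriv ℝ h x (Pi.single i 1) :=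
  ((hh.differentiable one_ne_zero) x).lineDeriv_eq_fderiv.symm

lemma pgrad_continuous {n : ℕ} {h : (Fin n → ℝ) → ℝ} (hh : ContDiff ℝ 1 h) (i : Fin n) :
    Continuous fun x => pgrad h x i := by
  unfold pgrad
  exact (hh.continuous_fderiv one_ne_zero).clm_apply continuous_const

lemma poincare (m : ℕ) : ∀ h : (Fin m → ℝ) → ℝ, ContDiff ℝ 1 h →
    symv h (gam m) ≤ 2 * ∫⁻ z, ∑ i, ENNReal.ofReal (pgrad h z i ^ 2) ∂(gam m) := by
  induction m with
  | zero =>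
    intro h _
    have : ∀ p q : Fin 0 → ℝ, h p - h q = 0 := fun p q => by rw [Subsingleton.elim p q, sub_self]
    simp [symv, this]
  | succ m ih =>
    intro h hh
    have hcons := contDiff_cons m
    have hF : ContDiff ℝ 1 (fun p : ℝ × (Fin m → ℝ) => h (Fin.cons p.1 p.2)) := hh.comp hcons
    rw [symv_map (gam_cons m) hh.continuous.measurable]
    refine (symv_prod hF.continuous.measurable).trans ?_
    have hmg : ∀ i, Measurable fun p : ℝ × (Fin m → ℝ) =>
        ENNReal.ofReal (pgrad h (Fin.cons p.1 p.2) i ^ 2) := fun i =>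
      (((pgrad_continuous hh i).comp hcons.continuous).measurable.pow_const 2).ennreal_ofReal
    have h1 : ∀ y : Fin m → ℝ, symv (fun x => h (Fin.cons x y)) (gaussianReal 0 1) ≤
        2 * ∫⁻ x, ENNReal.ofReal (pgrad h (Fin.cons x y) 0 ^ 2) ∂(gaussianReal 0 1) := by
      intro y
      have hc : ContDiff ℝ 1 (fun x : ℝ => h (Fin.cons x y)) :=
        hF.comp (contDiff_id.prodMk contDiff_const)
      rw [symv_eq hc.continuous.measurable]
      refine mul_le_mul_right ((poincare_one hc).trans (le_of_eq ?_)) _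
      refine lintegral_congr fun x => ?_
      congr 2
      rw [pgrad_eq_lineDeriv hh, lineDeriv]
      have : ∀ t : ℝ, (Fin.cons x y : Fin (m + 1) → ℝ) + t • Pi.single 0 1 = Fin.cons (x + t) y := by
        intro t
        ext i
        refine Fin.cases ?_ (fun i => ?_) i
        · simp
        · simp
      simp_rw [this]
      have e := deriv_comp_const_add (fun x : ℝ => h (Fin.cons x y)) x 0
      rw [add_zero] at e
      exact e.symm
    have h2 : ∀ x : ℝ, symv (fun y : Fin m → ℝ => h (Fin.cons x y)) (gam m) ≤
        2 * ∫⁻ y, ∑ i : Fin m, ENNReal.ofReal (pgrad h (Fin.cons x y) i.succ ^ 2) ∂(gam m) := by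
      intro x
      have hc : ContDiff ℝ 1 (fun y : Fin m → ℝ => h (Fin.cons x y)) :=
        hF.comp (contDiff_const.prodMk contDiff_id)
      refine (ih _ hc).trans (le_of_eq ?_)
      congr 1
      refine lintegral_congr fun y => Finset.sum_congr rfl fun i _ => ?_
      congr 2
      rw [pgrad_eq_lineDeriv hh, pgrad_eq_lineDeriv hc, lineDeriv, lineDeriv]
      have : ∀ t : ℝ, (Fin.cons x y : Fin (m + 1) → ℝ) + t • Pi.single i.succ 1 =
          (Fin.cons x (y + t • Pi.single i 1 : Fin m → ℝ) : Fin (m + 1) → ℝ) := by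
        intro t
        ext j
        refine Fin.cases ?_ (fun j => ?_) j
        · simp
        · simp [Pi.single_apply]
      simp_rw [this]
    refine (add_le_add (lintegral_mono h1) (lintegral_mono h2)).trans (le_of_eq ?_)
    rw [← (gam_cons m).lintegral_comp (Finset.measurable_fun_sum _ fun i _ =>
      ((pgrad_continuous hh i).measurable.pow_const 2).ennreal_ofReal)]
    simp_rw [Fin.sum_univ_succ]
    rw [lintegral_add_left (hmg 0), lintegral_const_mul' _ _ (by norm_num),
      lintegral_const_mul' _ _ (by norm_num), mul_add,
      lintegral_prod_symm _ (hmg 0).aemeasurable, lintegral_prod _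
        (Finset.measurable_fun_sum _ fun i _ => hmg i.succ).aemeasurable]

lemma poincare_evar {m : ℕ} {h : (Fin m → ℝ) → ℝ} (hh : ContDiff ℝ 1 h) :
    eVar[h; gam m] ≤ ∫⁻ z, ∑ i, ENNReal.ofReal (pgrad h z i ^ 2) ∂(gam m) := by
  have := poincare m h hh
  rw [symv_eq hh.continuous.measurable] at this
  exact (ENNReal.mul_le_mul_iff_right (by norm_num) (by norm_num)).1 this

lemma monte_carlo {α Ω : Type*} [MeasurableSpace α] [MeasurableSpace Ω] {γ : Measure α}
    [IsProbabilityMeasure γ] {P : Measure Ω} [IsProbabilityMeasure P] {N : ℕ} (hN : 1 ≤ N)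
    {h : α → ℝ} (hh : Measurable h) {Z : Fin N → Ω → α} (hZ : ∀ j, Measurable (Z j))
    (hlaw : ∀ j, Measure.map (Z j) P = γ) (hind : iIndepFun Z P) :
    ∫⁻ ω, ENNReal.ofReal (((∫ z, h z ∂γ) - (N : ℝ)⁻¹ * ∑ j, h (Z j ω)) ^ 2) ∂P ≤
      ENNReal.ofReal (N : ℝ)⁻¹ * eVar[h; γ] := by
  have hN0 : (0 : ℝ) < N := by exact_mod_cast hN
  by_cases hL : MemLp h 2 γ
  swap
  · rw [evariance_eq_top hh.aestronglyMeasurable hL, ENNReal.mul_top]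
    · exact le_top
    · simp [hN0]
  have hmp : ∀ j, MeasurePreserving (Z j) P γ := fun j => ⟨hZ j, hlaw j⟩
  let Y : Fin N → Ω → ℝ := fun j ω => h (Z j ω)
  have hY : ∀ j, MemLp (Y j) 2 P := fun j => hL.comp_measurePreserving (hmp j)
  have hYv : ∀ j, Var[Y j; P] = Var[h; γ] := by
    intro j
    rw [← hlaw j]
    exact (variance_map (by rw [hlaw j]; exact hh.aemeasurable) (hZ j).aemeasurable).symm
  have hYe : ∀ j, P[Y j] = ∫ z, h z ∂γ := by
    intro j
    rw [← hlaw j, integral_map (hZ j).aemeasurable hh.aestronglyMeasurable]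
  have hindY : iIndepFun Y P := hind.comp (fun _ => h) (fun _ => hh)
  have hvs : Var[∑ j, Y j; P] = N * Var[h; γ] := by
    rw [IndepFun.variance_sum (fun i _ => hY i) (fun i _ j _ hij => hindY.indepFun hij)]
    simp [hYv]
  let S : Ω → ℝ := fun ω => (N : ℝ)⁻¹ * (∑ j, Y j) ω
  have hS : MemLp S 2 P := (memLp_finsetSum' _ fun i _ => hY i).const_mul _
  have hSe : P[S] = ∫ z, h z ∂γ := by
    simp only [S, Finset.sum_apply]
    rw [integral_const_mul, integral_finsetSum _ fun i _ => (hY i).integrable one_le_two]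
    simp only [hYe]
    simp
    field_simp
  have hSv : Var[S; P] = (N : ℝ)⁻¹ * Var[h; γ] := by
    simp only [S]
    rw [variance_const_mul, hvs]
    field_simp
  have e : ∫⁻ ω, ENNReal.ofReal (((∫ z, h z ∂γ) - (N : ℝ)⁻¹ * ∑ j, h (Z j ω)) ^ 2) ∂P =
      eVar[S; P] := by
    rw [evariance_eq_lintegral_ofReal, hSe]
    refine lintegral_congr fun ω => ?_
    simp only [S, Finset.sum_apply, Y]
    congr 1
    ring
  rw [e, ← ofReal_variance hS, hSv, ENNReal.ofReal_mul (by positivity), ofReal_variance hL]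

lemma lin_alg {k m : ℕ} {W Wh : Matrix (Fin (k + m)) (Fin (k + m)) ℝ}
    (hW : Wᵀ * W = 1) (hWh : Whᵀ * Wh = 1) {Λ : Fin (k + m) → ℝ} (hΛ : ∀ i, 0 ≤ Λ i)
    {ε : ℝ} (hε : 0 < ε) (hpert : ‖W - Wh‖ ≤ ε) :
    ∑ j : Fin m, (Whᵀ * (W * Matrix.diagonal Λ * Wᵀ) * Wh) (Fin.natAdd k j) (Fin.natAdd k j) ≤
      (ε * Real.sqrt (∑ j : Fin k, Λ (Fin.castAdd m j)) +
        Real.sqrt (∑ j : Fin m, Λ (Fin.natAdd k j))) ^ 2 := by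
  let M : Matrix (Fin (k + m)) (Fin (k + m)) ℝ := Whᵀ * W
  have hWh' : Wh * Whᵀ = 1 := mul_eq_one_comm.1 hWh
  have hWht : Whᵀᵀ * Whᵀ = 1 := by rw [transpose_transpose, hWh']
  have e1 : ∀ i, (Whᵀ * (W * Matrix.diagonal Λ * Wᵀ) * Wh) i i = ∑ l, Λ l * M i l ^ 2 := by
    intro i
    have : Whᵀ * (W * Matrix.diagonal Λ * Wᵀ) * Wh = M * Matrix.diagonal Λ * Mᵀ := by
      simp only [M, transpose_mul, transpose_transpose, Matrix.mul_assoc]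
    rw [this, Matrix.mul_apply]
    simp only [Matrix.mul_diagonal, transpose_apply]
    refine Finset.sum_congr rfl fun l _ => ?_
    ring
  simp_rw [e1]
  rw [Finset.sum_comm, Fin.sum_univ_add]
  simp_rw [← Finset.mul_sum]
  have col : ∀ (A : Matrix (Fin (k + m)) (Fin (k + m)) ℝ) l,
      ∑ j : Fin m, (Whᵀ * A) (Fin.natAdd k j) l ^ 2 ≤ ∑ i, A i l ^ 2 := by
    intro A l
    have h := orth_sum_sq hWht (fun i => A i l)
    rw [← h, Fin.sum_univ_add]
    have h3 : ∀ i, (Whᵀ *ᵥ fun i => A i l) i = (Whᵀ * A) i l := fun i => rfl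
    simp_rw [h3]
    have : 0 ≤ ∑ i : Fin k, (Whᵀ * A) (Fin.castAdd m i) l ^ 2 :=
      Finset.sum_nonneg fun _ _ => sq_nonneg _
    linarith
  have c2 : ∀ l : Fin m, ∑ j : Fin m, M (Fin.natAdd k j) (Fin.natAdd k l) ^ 2 ≤ 1 := by
    intro l
    refine (col W _).trans (le_of_eq ?_)
    have := congrFun (congrFun hW (Fin.natAdd k l)) (Fin.natAdd k l)
    rw [Matrix.mul_apply, Matrix.one_apply_eq] at this
    rw [← this]
    refine Finset.sum_congr rfl fun i _ => ?_
    rw [transpose_apply, sq]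
  have c1 : ∀ l : Fin k, ∑ j : Fin m, M (Fin.natAdd k j) (Fin.castAdd m l) ^ 2 ≤ ε ^ 2 := by
    intro l
    have e : ∀ j : Fin m, M (Fin.natAdd k j) (Fin.castAdd m l) =
        (Whᵀ * (W - Wh)) (Fin.natAdd k j) (Fin.castAdd m l) := by
      intro j
      rw [Matrix.mul_sub, hWh, Matrix.sub_apply, Matrix.one_apply_ne, sub_zero]
      intro h
      have := congrArg Fin.val h
      simp at this
      omega
    simp_rw [e]
    refine (col _ _).trans ?_
    have h := (W - Wh).l2_opNorm_mulVec (EuclideanSpace.single (Fin.castAdd m l) (1 : ℝ))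
    have h2 : ‖(EuclideanSpace.equiv (Fin (k + m)) ℝ).symm
        ((W - Wh) *ᵥ (EuclideanSpace.single (Fin.castAdd m l) (1 : ℝ)))‖ ≤ ε := by
      refine h.trans ?_
      simpa using hpert
    have h3 := pow_le_pow_left₀ (norm_nonneg _) h2 2
    rw [EuclideanSpace.norm_sq_eq] at h3
    refine (le_of_eq ?_).trans h3
    refine Finset.sum_congr rfl fun i _ => ?_
    simp
  set S1 := ∑ j : Fin k, Λ (Fin.castAdd m j)
  set S2 := ∑ j : Fin m, Λ (Fin.natAdd k j)
  have hS1 : 0 ≤ S1 := Finset.sum_nonneg fun _ _ => hΛ _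
  have hS2 : 0 ≤ S2 := Finset.sum_nonneg fun _ _ => hΛ _
  have b1 : ∑ l : Fin k, Λ (Fin.castAdd m l) * ∑ j : Fin m, M (Fin.natAdd k j) (Fin.castAdd m l) ^ 2
      ≤ S1 * ε ^ 2 := by
    simp only [S1]
    rw [Finset.sum_mul]
    exact Finset.sum_le_sum fun l _ => mul_le_mul_of_nonneg_left (c1 l) (hΛ _)
  have b2 : ∑ l : Fin m, Λ (Fin.natAdd k l) * ∑ j : Fin m, M (Fin.natAdd k j) (Fin.natAdd k l) ^ 2
      ≤ S2 := by
    simp only [S2]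
    exact Finset.sum_le_sum fun l _ => mul_le_of_le_one_right (hΛ _) (c2 l)
  have s1 := Real.sq_sqrt hS1
  have s2 := Real.sq_sqrt hS2
  have : 0 ≤ ε * √S1 * √S2 := by positivity
  nlinarith [add_le_add b1 b2]

lemma ofReal_integral_le {α : Type*} [MeasurableSpace α] {μ : Measure α} {g : α → ℝ}
    (hg : ∀ x, 0 ≤ g x) : ENNReal.ofReal (∫ x, g x ∂μ) ≤ ∫⁻ x, ENNReal.ofReal (g x) ∂μ := by
  by_cases hi : Integrable g μ
  · rw [ofReal_integral_eq_lintegral_ofReal hi (ae_of_all _ hg)]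
  · rw [integral_undef hi]; simp

lemma lintegral_gam {n : ℕ} {g : (Fin n → ℝ) → ENNReal} (hg : Measurable g) :
    ∫⁻ x, g x ∂(gam n) = ∫⁻ x, g x * ENNReal.ofReal (gaussDensity n x) := by
  rw [gam_eq, lintegral_withDensity_eq_lintegral_mul _
    (gaussDensity_continuous n).measurable.ennreal_ofReal hg]
  simp [mul_comm]

lemma integral_gam {n : ℕ} (g : (Fin n → ℝ) → ℝ) :
    ∫ x, g x ∂(gam n) = ∫ x, g x * gaussDensity n x := by
  rw [gam_eq, integral_withDensity_eq_integral_toReal_smul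
    (gaussDensity_continuous n).measurable.ennreal_ofReal (ae_of_all _ fun _ => ENNReal.ofReal_lt_top)]
  refine integral_congr_ae (ae_of_all _ fun x => ?_)
  simp [ENNReal.toReal_ofReal (gaussDensity_nonneg n x), mul_comm]

lemma block_mulVec {k m : ℕ} (Wh : Matrix (Fin (k + m)) (Fin (k + m)) ℝ) (y : Fin k → ℝ)
    (z : Fin m → ℝ) : Wh.submatrix id (Fin.castAdd m) *ᵥ y + Wh.submatrix id (Fin.natAdd k) *ᵥ z =
      Wh *ᵥ Fin.append y z := by
  ext i
  simp [Matrix.mulVec, dotProduct, Fin.sum_univ_add]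

lemma block_transpose {k m : ℕ} {Wh : Matrix (Fin (k + m)) (Fin (k + m)) ℝ} (hWh : Whᵀ * Wh = 1)
    (y : Fin k → ℝ) (z : Fin m → ℝ) :
    (Wh.submatrix id (Fin.castAdd m))ᵀ *ᵥ (Wh *ᵥ Fin.append y z) = y := by
  have h : Whᵀ *ᵥ (Wh *ᵥ Fin.append y z) = Fin.append y z := by
    rw [Matrix.mulVec_mulVec, hWh, Matrix.one_mulVec]
  ext i
  have := congrFun h (Fin.castAdd m i)
  rw [Fin.append_left] at this
  exact this

/-- Directional derivative along the `i`-th column of `U`. -/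
noncomputable def cder {n : ℕ} (f : (Fin n → ℝ) → ℝ) (U : Matrix (Fin n) (Fin n) ℝ)
    (i : Fin n) (x : Fin n → ℝ) : ℝ := ∑ l, pgrad f x l * U l i

lemma pgrad_block {k m : ℕ} {f : (Fin (k + m) → ℝ) → ℝ} (hf : ContDiff ℝ 1 f)
    (Wh : Matrix (Fin (k + m)) (Fin (k + m)) ℝ) (y : Fin k → ℝ) (z : Fin m → ℝ) (i : Fin m) :
    pgrad (fun z => f (Wh.submatrix id (Fin.castAdd m) *ᵥ y +
      Wh.submatrix id (Fin.natAdd k) *ᵥ z)) z i =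
    cder f Wh (Fin.natAdd k i) (Wh *ᵥ Fin.append y z) := by
  have hc : ContDiff ℝ 1 (fun z => f (Wh.submatrix id (Fin.castAdd m) *ᵥ y +
      Wh.submatrix id (Fin.natAdd k) *ᵥ z)) := by
    refine hf.comp (contDiff_const.add ?_)
    exact (Matrix.mulVecLin (Wh.submatrix id (Fin.natAdd k))).toContinuousLinearMap.contDiff
  rw [pgrad_eq_lineDeriv hc, lineDeriv]
  simp_rw [Matrix.mulVec_add, Matrix.mulVec_smul, ← add_assoc, block_mulVec]
  change lineDeriv ℝ f (Wh *ᵥ Fin.append y z) (Wh.submatrix id (Fin.natAdd k) *ᵥ Pi.single i 1) = _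
  rw [((hf.differentiable one_ne_zero) _).lineDeriv_eq_fderiv]
  have := (fderiv ℝ f (Wh *ᵥ Fin.append y z)).toLinearMap.pi_apply_eq_sum_univ
    (Wh.submatrix id (Fin.natAdd k) *ᵥ Pi.single i 1)
  refine this.trans ?_
  unfold cder pgrad
  refine Finset.sum_congr rfl fun l _ => ?_
  rw [mul_comm]
  have e : (fun j => if l = j then (1 : ℝ) else 0) = Pi.single l 1 := by
    ext j; simp [Pi.single_apply, eq_comm]
  rw [e]
  simp

lemma cder_continuous {n : ℕ} {f : (Fin n → ℝ) → ℝ} (hf : ContDiff ℝ 1 f)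
    (U : Matrix (Fin n) (Fin n) ℝ) (i : Fin n) : Continuous (cder f U i) := by
  unfold cder
  exact continuous_finsetSum _ fun l _ => (pgrad_continuous hf l).mul continuous_const

lemma cder_integral {n : ℕ} {f : (Fin n → ℝ) → ℝ} (hf : ContDiff ℝ 1 f)
    (hsq : ∀ i, Integrable fun x => (pgrad f x i) ^ 2 * gaussDensity n x)
    (U : Matrix (Fin n) (Fin n) ℝ) (i : Fin n) :
    ∫⁻ x, ENNReal.ofReal (cder f U i x ^ 2) ∂(gam n) = ENNReal.ofReal
      ((Uᵀ * (Matrix.of fun i j => ∫ x, pgrad f x i * pgrad f x j * gaussDensity n x) * U) i i) := by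
  have hInt : ∀ a b, Integrable fun x => pgrad f x a * pgrad f x b * gaussDensity n x := by
    intro a b
    refine ((hsq a).add (hsq b)).mono' ?_ (ae_of_all _ fun x => ?_)
    · exact (((pgrad_continuous hf a).mul (pgrad_continuous hf b)).mul
        (gaussDensity_continuous n)).aestronglyMeasurable
    · simp only [Pi.add_apply]
      rw [Real.norm_eq_abs, abs_mul, abs_of_nonneg (gaussDensity_nonneg n x), ← add_mul]
      refine mul_le_mul_of_nonneg_right ?_ (gaussDensity_nonneg n x)
      rw [abs_le]
      constructor <;> nlinarith [sq_nonneg (pgrad f x a + pgrad f x b),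
        sq_nonneg (pgrad f x a - pgrad f x b), sq_nonneg (pgrad f x a), sq_nonneg (pgrad f x b)]
  have e : (fun x => cder f U i x ^ 2 * gaussDensity n x) = fun x => ∑ b, ∑ a,
      (U a i * U b i) * (pgrad f x a * pgrad f x b * gaussDensity n x) := by
    ext x
    unfold cder
    rw [sq, Finset.sum_mul_sum, Finset.sum_mul, Finset.sum_comm]
    simp_rw [Finset.sum_mul]
    rw [Finset.sum_comm]
    refine Finset.sum_congr rfl fun b _ => Finset.sum_congr rfl fun a _ => ?_
    ring
  have hI : Integrable fun x => cder f U i x ^ 2 * gaussDensity n x := by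
    rw [e]
    exact integrable_finsetSum _ fun b _ => integrable_finsetSum _ fun a _ => (hInt a b).const_mul _
  rw [lintegral_gam ((cder_continuous hf U i).measurable.pow_const 2).ennreal_ofReal]
  simp_rw [← ENNReal.ofReal_mul (sq_nonneg _)]
  rw [← ofReal_integral_eq_lintegral_ofReal hI (ae_of_all _ fun x =>
    mul_nonneg (sq_nonneg _) (gaussDensity_nonneg n x)), e,
    integral_finsetSum _ fun b _ => integrable_finsetSum _ fun a _ => (hInt a b).const_mul _]
  congr 1
  rw [Matrix.mul_apply]
  refine Finset.sum_congr rfl fun b _ => ?_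
  rw [integral_finsetSum _ fun a _ => (hInt a b).const_mul _, Matrix.mul_apply, Finset.sum_mul]
  refine Finset.sum_congr rfl fun a _ => ?_
  rw [integral_const_mul, transpose_apply, Matrix.of_apply]
  ring


set_option maxHeartbeats 1000000

/-- Perturbed Monte Carlo error bound in the Gaussian case: with
`C = ∫ ∇f ∇fᵀ ρX dx = W Λ Wᵀ`, perturbed orthogonal `Ŵ` (`Wh` below) with `‖W - Ŵ‖ ≤ ε` in
spectral norm, `ĝ` the conditional expectation over the perturbed inactive variable, and `ĝ_N`
its `N`-sample Monte Carlo approximation with i.i.d. samples of density `φ_m` jointly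
measurable in `(ŷ,ω)`, one has
`E[∫ (f_ĝ(x) - f_{ĝ_N}(x,·))² ρX(x) dx] ≤ (1/N)(ε(λ₁+⋯+λ_k)^{1/2} + (λ_{k+1}+⋯+λ_{k+m})^{1/2})²`. -/
theorem perturbed_monte_carlo_mse_bound
    (k m : ℕ)
    (f : (Fin (k + m) → ℝ) → ℝ)
    (hf : ContDiff ℝ 1 f)
    (hsq : ∀ i, Integrable fun x => (pgrad f x i) ^ 2 * gaussDensity (k + m) x)
    (W : Matrix (Fin (k + m)) (Fin (k + m)) ℝ)
    (hW : Wᵀ * W = 1)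
    (Λ : Fin (k + m) → ℝ)
    (hΛdesc : ∀ i j, i ≤ j → Λ j ≤ Λ i)
    (hΛnonneg : ∀ i, 0 ≤ Λ i)
    (hC : (Matrix.of fun i j => ∫ x, pgrad f x i * pgrad f x j * gaussDensity (k + m) x) =
      W * Matrix.diagonal Λ * Wᵀ)
    (Wh : Matrix (Fin (k + m)) (Fin (k + m)) ℝ)
    (hWh : Whᵀ * Wh = 1)
    (ε : ℝ) (hε : 0 < ε)
    (hpert : ‖W - Wh‖ ≤ ε)
    (gh : (Fin k → ℝ) → ℝ)
    (hgh : ∀ y, gh y = ∫ z, f (Wh.submatrix id (Fin.castAdd m) *ᵥ y +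
      Wh.submatrix id (Fin.natAdd k) *ᵥ z) * gaussDensity m z)
    (Ω : Type*) [MeasurableSpace Ω] (P : Measure Ω) [IsProbabilityMeasure P]
    (N : ℕ) (hN : 1 ≤ N)
    (Z : Fin N → (Fin k → ℝ) → Ω → (Fin m → ℝ))
    (hZmeas : ∀ j, Measurable fun p : (Fin k → ℝ) × Ω => Z j p.1 p.2)
    (hZlaw : ∀ j y, Measure.map (Z j y) P =
      volume.withDensity fun z => ENNReal.ofReal (gaussDensity m z))
    (hZindep : ∀ y, iIndepFun (fun j => Z j y) P)
    (ghN : (Fin k → ℝ) → Ω → ℝ)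
    (hghN : ∀ y ω, ghN y ω = (N : ℝ)⁻¹ * ∑ j, f (Wh.submatrix id (Fin.castAdd m) *ᵥ y +
      Wh.submatrix id (Fin.natAdd k) *ᵥ Z j y ω)) :
    ∫ ω, (∫ x, (gh ((Wh.submatrix id (Fin.castAdd m))ᵀ *ᵥ x) -
        ghN ((Wh.submatrix id (Fin.castAdd m))ᵀ *ᵥ x) ω) ^ 2 * gaussDensity (k + m) x) ∂P ≤
      (1 / N : ℝ) * (ε * Real.sqrt (∑ j : Fin k, Λ (Fin.castAdd m j)) +
        Real.sqrt (∑ j : Fin m, Λ (Fin.natAdd k j))) ^ 2 := by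
  have hN0 : (0 : ℝ) < N := by exact_mod_cast hN
  have hWh' : Wh * Whᵀ = 1 := mul_eq_one_comm.1 hWh
  set A := Wh.submatrix id (Fin.castAdd m) with hA
  set B := Wh.submatrix id (Fin.natAdd k) with hB
  have hfm := hf.continuous.measurable
  have hcont : Continuous fun p : (Fin k → ℝ) × (Fin m → ℝ) => f (A *ᵥ p.1 + B *ᵥ p.2) :=
    hf.continuous.comp (by fun_prop)
  have hAm : Measurable fun x => Aᵀ *ᵥ x :=
    (show Continuous fun x => Aᵀ *ᵥ x by fun_prop).measurable
  have hgh' : ∀ y, gh y = ∫ z, f (A *ᵥ y + B *ᵥ z) ∂(gam m) := by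
    intro y
    rw [hgh, integral_gam]
  have hghm : Measurable gh := by
    have : gh = fun y => ∫ z, f (A *ᵥ y + B *ᵥ z) ∂(gam m) := funext hgh'
    rw [this]
    exact (hcont.stronglyMeasurable.integral_prod_right (ν := gam m)).measurable
  have hghNm : Measurable fun p : (Fin k → ℝ) × Ω => ghN p.1 p.2 := by
    simp_rw [hghN]
    refine Measurable.const_mul (Finset.measurable_fun_sum _ fun j _ => ?_) _
    exact hcont.measurable.comp (measurable_fst.prodMk (hZmeas j))
  let c : ENNReal := ENNReal.ofReal (N : ℝ)⁻¹
  let Q : (Fin k → ℝ) → ENNReal := fun y =>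
    ∫⁻ z, ∑ i : Fin m, ENNReal.ofReal (cder f Wh (Fin.natAdd k i) (Wh *ᵥ Fin.append y z) ^ 2) ∂(gam m)
  have hD : Measurable fun x => ∑ i : Fin m,
      ENNReal.ofReal (cder f Wh (Fin.natAdd k i) x ^ 2) :=
    Finset.measurable_fun_sum _ fun i _ =>
      ((cder_continuous hf Wh _).measurable.pow_const 2).ennreal_ofReal
  have hWm : Measurable fun x => Wh *ᵥ x := (gam_orth hWh).measurable
  have hDp : Measurable fun p : (Fin k → ℝ) × (Fin m → ℝ) => ∑ i : Fin m,
      ENNReal.ofReal (cder f Wh (Fin.natAdd k i) (Wh *ᵥ Fin.append p.1 p.2) ^ 2) :=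
    hD.comp (hWm.comp (gam_append k m).measurable)
  have hQm : Measurable Q := hDp.lintegral_prod_right'
  have hpt : ∀ y, ∫⁻ ω, ENNReal.ofReal ((gh y - ghN y ω) ^ 2) ∂P ≤ c * Q y := by
    intro y
    have hc : ContDiff ℝ 1 (fun z => f (A *ᵥ y + B *ᵥ z)) := by
      refine hf.comp (contDiff_const.add ?_)
      exact (Matrix.mulVecLin B).toContinuousLinearMap.contDiff
    have h1 := monte_carlo (γ := gam m) (P := P) hN hc.continuous.measurable (Z := fun j => Z j y)
      (fun j => (hZmeas j).comp measurable_prodMk_left) (fun j => by rw [hZlaw, gam_eq]) (hZindep y)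
    simp_rw [hgh', hghN]
    refine h1.trans (mul_le_mul_right ((poincare_evar hc).trans (le_of_eq ?_)) _)
    refine lintegral_congr fun z => Finset.sum_congr rfl fun i _ => ?_
    rw [hA, hB, pgrad_block hf]
  have hQ : ∫⁻ x, Q (Aᵀ *ᵥ x) ∂(gam (k + m)) ≤
      ENNReal.ofReal ((ε * Real.sqrt (∑ j : Fin k, Λ (Fin.castAdd m j)) +
        Real.sqrt (∑ j : Fin m, Λ (Fin.natAdd k j))) ^ 2) := by
    have hQA : Measurable fun x => Q (Aᵀ *ᵥ x) := hQm.comp hAm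
    have hQAW : Measurable fun x => Q (Aᵀ *ᵥ (Wh *ᵥ x)) := hQA.comp hWm
    rw [← (gam_orth hWh).lintegral_comp hQA, ← (gam_append k m).lintegral_comp hQAW]
    simp only [hA, block_transpose hWh]
    have hQ1 : Measurable fun p : (Fin k → ℝ) × (Fin m → ℝ) => Q p.1 := hQm.comp measurable_fst
    have hDW : Measurable fun x => ∑ i : Fin m,
        ENNReal.ofReal (cder f Wh (Fin.natAdd k i) (Wh *ᵥ x) ^ 2) := hD.comp hWm
    have e1 : ∫⁻ p : (Fin k → ℝ) × (Fin m → ℝ), Q p.1 ∂((gam k).prod (gam m)) =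
        ∫⁻ x, ∑ i : Fin m, ENNReal.ofReal (cder f Wh (Fin.natAdd k i) x ^ 2) ∂(gam (k + m)) := by
      rw [← (gam_orth hWh).lintegral_comp hD, ← (gam_append k m).lintegral_comp hDW,
        lintegral_prod _ hDp.aemeasurable,
        lintegral_prod _ hQ1.aemeasurable]
      simp [Q]
    rw [e1, lintegral_finsetSum _ fun i _ =>
      ((cder_continuous hf Wh _).measurable.pow_const 2).ennreal_ofReal]
    simp_rw [cder_integral hf hsq, hC]
    rw [← ENNReal.ofReal_sum_of_nonneg]
    · exact ENNReal.ofReal_le_ofReal (lin_alg hW hWh hΛnonneg hε hpert)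
    · intro i _
      have hps : (Matrix.diagonal Λ).PosSemidef := Matrix.PosSemidef.diagonal hΛnonneg
      have h2 := (hps.mul_mul_conjTranspose_same W).conjTranspose_mul_mul_same Wh
      have h3 := h2.diag_nonneg (i := Fin.natAdd k i)
      simpa [Matrix.conjTranspose_eq_transpose_of_trivial] using h3
  have hb : 0 ≤ (1 / N : ℝ) * (ε * Real.sqrt (∑ j : Fin k, Λ (Fin.castAdd m j)) +
        Real.sqrt (∑ j : Fin m, Λ (Fin.natAdd k j))) ^ 2 := by positivity
  refine (ENNReal.ofReal_le_ofReal_iff hb).1 ?_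
  have hnn : ∀ ω x, 0 ≤ (gh (Aᵀ *ᵥ x) - ghN (Aᵀ *ᵥ x) ω) ^ 2 * gaussDensity (k + m) x :=
    fun ω x => mul_nonneg (sq_nonneg _) (gaussDensity_nonneg _ _)
  have hJ : Measurable fun p : Ω × (Fin (k + m) → ℝ) =>
      ENNReal.ofReal ((gh (Aᵀ *ᵥ p.2) - ghN (Aᵀ *ᵥ p.2) p.1) ^ 2) := by
    have h1 : Measurable fun p : Ω × (Fin (k + m) → ℝ) => gh (Aᵀ *ᵥ p.2) :=
      hghm.comp (hAm.comp measurable_snd)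
    have h2 : Measurable fun p : Ω × (Fin (k + m) → ℝ) => ghN (Aᵀ *ᵥ p.2) p.1 :=
      hghNm.comp ((hAm.comp measurable_snd).prodMk measurable_fst)
    exact ((h1.sub h2).pow_const 2).ennreal_ofReal
  calc _ ≤ ∫⁻ ω, ENNReal.ofReal (∫ x, (gh (Aᵀ *ᵥ x) - ghN (Aᵀ *ᵥ x) ω) ^ 2 *
          gaussDensity (k + m) x) ∂P :=
        ofReal_integral_le fun ω => integral_nonneg (hnn ω)
    _ ≤ ∫⁻ ω, ∫⁻ x, ENNReal.ofReal ((gh (Aᵀ *ᵥ x) - ghN (Aᵀ *ᵥ x) ω) ^ 2) ∂(gam (k + m)) ∂P := by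
        refine lintegral_mono fun ω => (ofReal_integral_le (hnn ω)).trans (le_of_eq ?_)
        have hJω : Measurable fun x =>
            ENNReal.ofReal ((gh (Aᵀ *ᵥ x) - ghN (Aᵀ *ᵥ x) ω) ^ 2) :=
          Measurable.comp (g := fun p : Ω × (Fin (k + m) → ℝ) =>
            ENNReal.ofReal ((gh (Aᵀ *ᵥ p.2) - ghN (Aᵀ *ᵥ p.2) p.1) ^ 2)) (f := fun x => (ω, x))
            hJ measurable_prodMk_left
        rw [lintegral_gam hJω]
        refine lintegral_congr fun x => ?_
        rw [ENNReal.ofReal_mul (sq_nonneg _)]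
    _ = ∫⁻ x, ∫⁻ ω, ENNReal.ofReal ((gh (Aᵀ *ᵥ x) - ghN (Aᵀ *ᵥ x) ω) ^ 2) ∂P ∂(gam (k + m)) :=
        lintegral_lintegral_swap hJ.aemeasurable
    _ ≤ ∫⁻ x, c * Q (Aᵀ *ᵥ x) ∂(gam (k + m)) := lintegral_mono fun x => hpt _
    _ = c * ∫⁻ x, Q (Aᵀ *ᵥ x) ∂(gam (k + m)) := lintegral_const_mul' _ _ ENNReal.ofReal_ne_top
    _ ≤ _ := by
        rw [one_div, ENNReal.ofReal_mul (by positivity)]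
        exact mul_le_mul_right hQ _
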